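/- arXiv:2303.03358 — 2 statements merged into one kernel-verified Lean document; each statement's English description precedes it below -/
import Mathlib

section
/- Let A be a d×d real symmetric matrix, b ∈ R^d, k a positive integer with dim K_k(A,b) = k, Q a d×k matrix with orthonormal columns spanning K_k(A,b), and T = Qᵀ A Q. Let r(x) = n(x)/m(x) with m(x) = ∏_{i=1}^{q}(x − z_i), all z_i real and outside [λmin(A), λmax(A)], and suppose k > deg(n). For 1 ≤ j ≤ q let r_j(x) = n(x)/∏_{i=1}^{j}(x − z_i), let A_j = ±(A − z_j I) be positive definite, and let opt_k(r_j; A_j) denote the minimizer of ‖r_j(A)b − x‖_{A_j} over x ∈ K_k(A,b). Then r(A)b − Q r(T) Qᵀ b = Σ_{j=1}^{q} [ ∏_{i=j+1}^{q} Q (T − z_i I)^{-1} Qᵀ ] ( r_j(A)b − opt_k(r_j; A_j) ), where the empty product (j = q) is the identity matrix. -/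
open Matrix Polynomial

noncomputable section

/-- Euclidean norm of a vector in `ℝ^d`. -/
def enorm {d : ℕ} (x : Fin d → ℝ) : ℝ := Real.sqrt (x ⬝ᵥ x)

/-- The `M`-weighted norm `‖x‖_M = √(xᵀ M x)`. -/
def mnorm {d : ℕ} (M : Matrix (Fin d) (Fin d) ℝ) (x : Fin d → ℝ) : ℝ :=
  Real.sqrt (x ⬝ᵥ M *ᵥ x)

/-- Krylov subspace `K_k(A,b) = span{b, Ab, ..., A^{k-1} b}`. -/
def Krylov {d : ℕ} (A : Matrix (Fin d) (Fin d) ℝ) (b : Fin d → ℝ) (k : ℕ) :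
    Submodule ℝ (Fin d → ℝ) :=
  Submodule.span ℝ (Set.range fun j : Fin k => (A ^ (j : ℕ)) *ᵥ b)

/-- Smallest eigenvalue of a symmetric matrix (junk value `0` otherwise). -/
def lammin {d : ℕ} (M : Matrix (Fin d) (Fin d) ℝ) : ℝ :=
  if h : M.IsHermitian then ⨅ i, h.eigenvalues i else 0

/-- Largest eigenvalue of a symmetric matrix (junk value `0` otherwise). -/
def lammax {d : ℕ} (M : Matrix (Fin d) (Fin d) ℝ) : ℝ :=
  if h : M.IsHermitian then ⨆ i, h.eigenvalues i else 0

/-- Condition number `κ(M) = λmax(M)/λmin(M)`. -/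
def kappa {d : ℕ} (M : Matrix (Fin d) (Fin d) ℝ) : ℝ := lammax M / lammin M

/-- `mij zs i j` is the polynomial `m_{i,j}(x) = ∏_{t=i}^{j} (x - z_t)`. -/
def mij (zs : ℕ → ℝ) (i j : ℕ) : Polynomial ℝ := ∏ t ∈ Finset.Icc i j, (X - C (zs t))

/-- `A_z = +(A - z I)` if `z < λmin(A)` and `-(A - z I)` otherwise; signed so as to be
positive definite when `z` lies outside the interval `[λmin(A), λmax(A)]`. -/
def shiftSgn {d : ℕ} (A : Matrix (Fin d) (Fin d) ℝ) (z : ℝ) : Matrix (Fin d) (Fin d) ℝ :=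
  if z < lammin A then A - z • 1 else -(A - z • 1)

/-- Spectral norm (ℓ²-operator norm) of a square matrix. -/
def specNorm {d : ℕ} (M : Matrix (Fin d) (Fin d) ℝ) : ℝ :=
  ‖Matrix.toEuclideanCLM (𝕜 := ℝ) M‖

/-- Matrix function `f(M)` defined via the spectral decomposition of a symmetric matrix
(junk value `0` if `M` is not symmetric). -/
def matFn {d : ℕ} (M : Matrix (Fin d) (Fin d) ℝ) (f : ℝ → ℝ) : Matrix (Fin d) (Fin d) ℝ :=
  if h : M.IsHermitian then h.cfc f else 0

/-- Subtracting a multiple of the identity that lies below the spectrum leaves a positive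
definite matrix. -/
theorem posDef_sub_smul_one {d : ℕ} {A : Matrix (Fin d) (Fin d) ℝ} (hA : A.IsHermitian)
    {z : ℝ} (hz : ∀ i, z < hA.eigenvalues i) : (A - z • 1).PosDef := by
  have hB : (A - z • (1 : Matrix (Fin d) (Fin d) ℝ)).IsHermitian :=
    hA.sub (isHermitian_one.smul (IsSelfAdjoint.all z))
  rw [hB.posDef_iff_eigenvalues_pos]
  intro i
  have hi : hB.eigenvalues i ∈ spectrum ℝ (A - algebraMap ℝ (Matrix (Fin d) (Fin d) ℝ) z) := by
    rw [Algebra.algebraMap_eq_smul_one, hB.spectrum_real_eq_range_eigenvalues]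
    exact ⟨i, rfl⟩
  rw [← spectrum.sub_singleton_eq, hA.spectrum_real_eq_range_eigenvalues] at hi
  obtain ⟨_, ⟨l, rfl⟩, _, rfl, hl⟩ := hi
  have := hz l
  dsimp only at hl
  linarith

/-- Subtracting a Hermitian matrix from a multiple of the identity that lies above its spectrum
gives a positive definite matrix. -/
theorem posDef_neg_sub_smul_one {d : ℕ} {A : Matrix (Fin d) (Fin d) ℝ} (hA : A.IsHermitian)
    {z : ℝ} (hz : ∀ i, hA.eigenvalues i < z) : (-(A - z • 1)).PosDef := by
  have hB : (-(A - z • (1 : Matrix (Fin d) (Fin d) ℝ))).IsHermitian :=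
    (hA.sub (isHermitian_one.smul (IsSelfAdjoint.all z))).neg
  rw [hB.posDef_iff_eigenvalues_pos]
  intro i
  have hi : hB.eigenvalues i ∈ spectrum ℝ (algebraMap ℝ (Matrix (Fin d) (Fin d) ℝ) z - A) := by
    rw [Algebra.algebraMap_eq_smul_one, ← neg_sub A, hB.spectrum_real_eq_range_eigenvalues]
    exact ⟨i, rfl⟩
  rw [← spectrum.singleton_sub_eq, hA.spectrum_real_eq_range_eigenvalues] at hi
  obtain ⟨_, rfl, _, ⟨l, rfl⟩, hl⟩ := hi
  have := hz l
  dsimp only at hl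
  linarith

theorem posDef_shiftSgn {d : ℕ} {A : Matrix (Fin d) (Fin d) ℝ} (hA : A.IsHermitian) {z : ℝ}
    (hz : z < lammin A ∨ lammax A < z) : (shiftSgn A z).PosDef := by
  unfold shiftSgn
  split_ifs with h
  · refine posDef_sub_smul_one hA fun i => h.trans_le ?_
    rw [lammin, dif_pos hA]
    exact ciInf_le (Set.finite_range _).bddBelow i
  · refine posDef_neg_sub_smul_one hA fun i => lt_of_le_of_lt ?_ (hz.resolve_left h)
    rw [lammax, dif_pos hA]
    exact le_ciSup (Set.finite_range _).bddAbove i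

theorem shiftSgn_eq_or_eq_neg {d : ℕ} (A : Matrix (Fin d) (Fin d) ℝ) (z : ℝ) :
    shiftSgn A z = A - z • 1 ∨ shiftSgn A z = -(A - z • 1) := by
  unfold shiftSgn
  split_ifs <;> simp

/-- The residual of a best approximation in the `M`-norm is `M`-orthogonal to the subspace. -/
theorem dotProduct_mulVec_sub_eq_zero_of_mnorm_le {d : ℕ} {M : Matrix (Fin d) (Fin d) ℝ}
    (hM : M.PosDef) {K : Submodule ℝ (Fin d → ℝ)} {v x : Fin d → ℝ} (hx : x ∈ K)
    (hmin : ∀ w ∈ K, mnorm M (v - x) ≤ mnorm M (v - w)) {w : Fin d → ℝ} (hw : w ∈ K) :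
    w ⬝ᵥ M *ᵥ (v - x) = 0 := by
  set e := v - x with he
  have hsymm : e ⬝ᵥ M *ᵥ w = w ⬝ᵥ M *ᵥ e := by
    have hMt : Mᵀ = M := by simpa using hM.1.eq
    rw [dotProduct_mulVec, ← mulVec_transpose, hMt, dotProduct_comm]
  have hquad : ∀ t : ℝ, 0 ≤ (w ⬝ᵥ M *ᵥ w) * (t * t) + (-2 * (w ⬝ᵥ M *ᵥ e)) * t + 0 := by
    intro t
    have h := hmin (x + t • w) (K.add_mem hx (K.smul_mem t hw))
    have hnonneg : 0 ≤ (v - (x + t • w)) ⬝ᵥ M *ᵥ (v - (x + t • w)) := by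
      simpa using hM.posSemidef.dotProduct_mulVec_nonneg (v - (x + t • w))
    rw [mnorm, mnorm, Real.sqrt_le_sqrt_iff hnonneg, ← sub_sub, ← he] at h
    simp only [mulVec_sub, mulVec_smul, dotProduct_sub, sub_dotProduct, dotProduct_smul,
      smul_dotProduct, smul_eq_mul, hsymm] at h
    linarith
  have hd := discrim_le_zero hquad
  rw [discrim] at hd
  nlinarith [sq_nonneg (w ⬝ᵥ M *ᵥ e)]

theorem mij_one_succ (zs : ℕ → ℝ) (j : ℕ) :
    mij zs 1 (j + 1) = mij zs 1 j * (X - C (zs (j + 1))) :=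
  Finset.prod_Icc_succ_top (Nat.le_add_left 1 j) _

/-- Multiplying by `M - z_{j+1}` removes the last pole of the rational function. -/
theorem sub_smul_one_mul_aeval_mij_succ {m : ℕ} (M : Matrix (Fin m) (Fin m) ℝ) (zs : ℕ → ℝ)
    (n : Polynomial ℝ) (j : ℕ) (h : IsUnit (M - zs (j + 1) • 1)) :
    (M - zs (j + 1) • 1) * (aeval M n * (aeval M (mij zs 1 (j + 1)))⁻¹)
      = aeval M n * (aeval M (mij zs 1 j))⁻¹ := by
  have hX : aeval M (X - C (zs (j + 1))) = M - zs (j + 1) • 1 := by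
    simp [Algebra.algebraMap_eq_smul_one]
  have hcomm : (M - zs (j + 1) • 1) * aeval M n = aeval M n * (M - zs (j + 1) • 1) := by
    rw [← hX, ← map_mul, mul_comm, map_mul]
  rw [mij_one_succ, map_mul, hX, Matrix.mul_inv_rev, ← mul_assoc, hcomm, mul_assoc,
    Matrix.mul_nonsing_inv_cancel_left _ _ ((Matrix.isUnit_iff_isUnit_det _).mp h)]

theorem commute_inv_sub_smul_one {m : ℕ} (M : Matrix (Fin m) (Fin m) ℝ) (y z : ℝ) :
    Commute (M - y • 1)⁻¹ (M - z • 1)⁻¹ := by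
  have h : Commute (M - z • 1) (M - y • 1) :=
    (Commute.sub_left (Commute.sub_right (Commute.refl M) ((Commute.one_right M).smul_right y))
      ((Commute.one_left _).smul_left z))
  rw [Commute, SemiconjBy, ← Matrix.mul_inv_rev, ← Matrix.mul_inv_rev, h.eq]

/-- A linear recurrence with commuting coefficients, solved in closed form. -/
theorem eq_sum_prod_mulVec_of_recurrence {d q : ℕ} (B : ℕ → Matrix (Fin d) (Fin d) ℝ)
    (hB : ∀ i j, Commute (B i) (B j)) (e f : ℕ → Fin d → ℝ) (h0 : e 0 = 0)
    (hsucc : ∀ j < q, e (j + 1) = f (j + 1) + B (j + 1) *ᵥ e j) :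
    e q = ∑ j ∈ Finset.Icc 1 q, ((List.range (q - j)).map fun t => B (j + 1 + t)).prod *ᵥ f j := by
  induction q with
  | zero => simp [h0]
  | succ q ih =>
    rw [hsucc q q.lt_succ_self, ih fun j hj => hsucc j (hj.trans q.lt_succ_self),
      Finset.sum_Icc_succ_top (Nat.le_add_left 1 q), mulVec_sum, add_comm]
    congr 1
    · refine Finset.sum_congr rfl fun j hj => ?_
      have hjq := (Finset.mem_Icc.mp hj).2
      rw [Nat.succ_sub hjq, List.range_succ, List.map_append, List.prod_append, List.map_singleton,
        List.prod_singleton, show j + 1 + (q - j) = q + 1 by omega, mulVec_mulVec]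
      congr 1
      refine Commute.list_prod_right _ _ fun M hM => ?_
      obtain ⟨t, -, rfl⟩ := List.mem_map.mp hM
      exact hB _ _
    · simp

/-- The columns of `Q` parametrize their span. -/
theorem mem_span_columns_iff {d k : ℕ} (Q : Matrix (Fin d) (Fin k) ℝ) (v : Fin d → ℝ) :
    v ∈ Submodule.span ℝ (Set.range fun i : Fin k => fun j : Fin d => Q j i)
      ↔ ∃ c, Q *ᵥ c = v := by
  rw [show (fun i : Fin k => fun j : Fin d => Q j i) = Q.col from rfl, ← Matrix.range_mulVecLin]
  rfl

/-- Lanczos-FA is exact on polynomials of degree less than `k`. -/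
theorem aeval_mulVec_eq_lanczos {d k : ℕ} {A : Matrix (Fin d) (Fin d) ℝ} {b : Fin d → ℝ}
    {Q : Matrix (Fin d) (Fin k) ℝ} (hproj : ∀ v ∈ Krylov A b k, Q *ᵥ Qᵀ *ᵥ v = v)
    {n : Polynomial ℝ} (hn : n.natDegree < k) :
    aeval A n *ᵥ b = Q *ᵥ aeval (Qᵀ * A * Q) n *ᵥ Qᵀ *ᵥ b := by
  have hpow : ∀ j < k, A ^ j *ᵥ b = Q *ᵥ (Qᵀ * A * Q) ^ j *ᵥ Qᵀ *ᵥ b := by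
    intro j hj
    rw [← hproj (A ^ j *ᵥ b) (Submodule.subset_span ⟨⟨j, hj⟩, rfl⟩)]
    congr 1
    induction j with
    | zero => simp
    | succ j ih =>
      have hj' : j < k := (Nat.lt_succ_self j).trans hj
      have hA : A ^ j *ᵥ b = Q *ᵥ (Qᵀ * A * Q) ^ j *ᵥ Qᵀ *ᵥ b := by
        rw [← ih hj', hproj (A ^ j *ᵥ b) (Submodule.subset_span ⟨⟨j, hj'⟩, rfl⟩)]
      rw [pow_succ', ← mulVec_mulVec, hA, pow_succ']
      simp only [mulVec_mulVec, Matrix.mul_assoc]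
  rw [aeval_eq_sum_range' hn, aeval_eq_sum_range' hn, sum_mulVec, sum_mulVec, mulVec_sum]
  refine Finset.sum_congr rfl fun j hj => ?_
  rw [smul_mulVec, smul_mulVec, mulVec_smul, hpow j (Finset.mem_range.mp hj)]

/-- Lemma 3 of the paper: telescoping decomposition of the Lanczos-FA error
in terms of the `A_j`-norm-optimal Krylov approximations `opt_k(r_j; A_j)`. -/
theorem lanczosFA_error_telescoping
    {d k q : ℕ} (A : Matrix (Fin d) (Fin d) ℝ) (hA : A.IsHermitian) (b : Fin d → ℝ)
    (hk : 0 < k) (hdim : Module.finrank ℝ ↥(Krylov A b k) = k)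
    (Q : Matrix (Fin d) (Fin k) ℝ) (hQ : Qᵀ * Q = 1)
    (hspan : Submodule.span ℝ
      (Set.range fun i : Fin k => fun j : Fin d => Q j i) = Krylov A b k)
    (zs : ℕ → ℝ)
    (hz : ∀ i, 1 ≤ i → i ≤ q → zs i < lammin A ∨ lammax A < zs i)
    (n : Polynomial ℝ) (hkn : n.natDegree < k)
    (xopt : ℕ → Fin d → ℝ)
    (hxmem : ∀ j, 1 ≤ j → j ≤ q → xopt j ∈ Krylov A b k)
    (hxopt : ∀ j, 1 ≤ j → j ≤ q → ∀ w ∈ Krylov A b k,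
      mnorm (shiftSgn A (zs j))
          ((aeval A n * (aeval A (mij zs 1 j))⁻¹) *ᵥ b - xopt j)
        ≤ mnorm (shiftSgn A (zs j))
            ((aeval A n * (aeval A (mij zs 1 j))⁻¹) *ᵥ b - w)) :
    (aeval A n * (aeval A (mij zs 1 q))⁻¹) *ᵥ b
        - (Q * (aeval (Qᵀ * A * Q) n * (aeval (Qᵀ * A * Q) (mij zs 1 q))⁻¹) * Qᵀ) *ᵥ b
      = ∑ j ∈ Finset.Icc 1 q,
          (((List.range (q - j)).map fun t =>
              Q * (Qᵀ * A * Q - zs (j + 1 + t) • 1)⁻¹ * Qᵀ).prod) *ᵥ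
            ((aeval A n * (aeval A (mij zs 1 j))⁻¹) *ᵥ b - xopt j) := by
  have hQinj : Function.Injective Q.mulVec := fun x y h => by
    simpa [mulVec_mulVec, hQ] using congrArg (Qᵀ *ᵥ ·) h
  have hmem : ∀ v, v ∈ Krylov A b k ↔ ∃ c, Q *ᵥ c = v := fun v => by
    rw [← hspan, mem_span_columns_iff]
  have hproj : ∀ v ∈ Krylov A b k, Q *ᵥ Qᵀ *ᵥ v = v := fun v hv => by
    obtain ⟨c, rfl⟩ := (hmem v).mp hv
    rw [mulVec_mulVec _ Qᵀ, hQ, one_mulVec]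
  have hpd : ∀ j < q, (shiftSgn A (zs (j + 1))).PosDef := fun j hj =>
    posDef_shiftSgn hA (hz (j + 1) (Nat.le_add_left 1 j) hj)
  have hTshift : ∀ z : ℝ, Qᵀ * (A - z • 1) * Q = Qᵀ * A * Q - z • 1 := fun z => by
    simp [Matrix.mul_sub, Matrix.sub_mul, hQ]
  have hunitA : ∀ j < q, IsUnit (A - zs (j + 1) • 1) := fun j hj => by
    have hu := (hpd j hj).isUnit
    rcases shiftSgn_eq_or_eq_neg A (zs (j + 1)) with h | h <;> rw [h] at hu
    · exact hu
    · exact IsUnit.neg_iff _ |>.mp hu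
  have hunitT : ∀ j < q, IsUnit (Qᵀ * A * Q - zs (j + 1) • 1) := fun j hj => by
    have hu := ((hpd j hj).conjTranspose_mul_mul_same hQinj).isUnit
    rw [conjTranspose_eq_transpose_of_trivial] at hu
    rcases shiftSgn_eq_or_eq_neg A (zs (j + 1)) with h | h <;> rw [h] at hu
    · rwa [hTshift] at hu
    · rw [Matrix.mul_neg, Matrix.neg_mul, hTshift] at hu
      exact IsUnit.neg_iff _ |>.mp hu
  set T := Qᵀ * A * Q with hT
  have hopt : ∀ j < q, xopt (j + 1) = (Q * (T - zs (j + 1) • 1)⁻¹ * Qᵀ) *ᵥ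
      (aeval A n * (aeval A (mij zs 1 j))⁻¹) *ᵥ b := by
    intro j hj
    have hx := hxmem (j + 1) (Nat.le_add_left 1 j) hj
    set v := (aeval A n * (aeval A (mij zs 1 (j + 1)))⁻¹) *ᵥ b with hv
    have horth : ∀ w ∈ Krylov A b k, w ⬝ᵥ (A - zs (j + 1) • 1) *ᵥ (v - xopt (j + 1)) = 0 := by
      intro w hw
      have h := dotProduct_mulVec_sub_eq_zero_of_mnorm_le (hpd j hj) hx
        (hxopt (j + 1) (Nat.le_add_left 1 j) hj) hw
      rcases shiftSgn_eq_or_eq_neg A (zs (j + 1)) with hs | hs <;> rw [hs] at h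
      · exact h
      · simpa only [neg_mulVec, dotProduct_neg, neg_eq_zero] using h
    have hres : Qᵀ *ᵥ (A - zs (j + 1) • 1) *ᵥ (v - xopt (j + 1)) = 0 := by
      refine dotProduct_eq_zero _ fun c => ?_
      rw [dotProduct_comm, dotProduct_mulVec, vecMul_transpose]
      exact horth _ ((hmem _).mpr ⟨c, rfl⟩)
    obtain ⟨c, hc⟩ := (hmem _).mp hx
    rw [mulVec_sub, hv, mulVec_mulVec _ (A - _), sub_smul_one_mul_aeval_mij_succ A zs n j
      (hunitA j hj), ← hc, mulVec_sub, sub_eq_zero, mulVec_mulVec c, mulVec_mulVec c,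
      ← Matrix.mul_assoc, hTshift] at hres
    rw [← hc, ← mulVec_mulVec _ _ Qᵀ, hres, mulVec_mulVec, Matrix.mul_assoc,
      Matrix.nonsing_inv_mul _ ((Matrix.isUnit_iff_isUnit_det _).mp (hunitT j hj)), Matrix.mul_one]
  refine eq_sum_prod_mulVec_of_recurrence (fun i => Q * (T - zs i • 1)⁻¹ * Qᵀ) ?_
    (fun j => (aeval A n * (aeval A (mij zs 1 j))⁻¹) *ᵥ b
      - (Q * (aeval T n * (aeval T (mij zs 1 j))⁻¹) * Qᵀ) *ᵥ b) _ ?_ ?_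
  · intro i j
    have hmul : ∀ M N : Matrix (Fin k) (Fin k) ℝ,
        Q * M * Qᵀ * (Q * N * Qᵀ) = Q * (M * N) * Qᵀ := fun M N => by
      rw [show Q * M * Qᵀ * (Q * N * Qᵀ) = Q * M * (Qᵀ * Q) * N * Qᵀ by
        simp only [Matrix.mul_assoc], hQ, Matrix.mul_one, Matrix.mul_assoc Q M]
    rw [Commute, SemiconjBy, hmul, hmul, (commute_inv_sub_smul_one T (zs i) (zs j)).eq]
  · simp only [mij, Finset.Icc_eq_empty_of_lt Nat.zero_lt_one, Finset.prod_empty, map_one, inv_one,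
      mul_one, aeval_mulVec_eq_lanczos hproj hkn, ← mulVec_mulVec, ← hT, sub_self]
  · intro j hj
    have hlanczos : (Q * (aeval T n * (aeval T (mij zs 1 (j + 1)))⁻¹) * Qᵀ) *ᵥ b
        = (Q * (T - zs (j + 1) • 1)⁻¹ * Qᵀ) *ᵥ
          (Q * (aeval T n * (aeval T (mij zs 1 j))⁻¹) * Qᵀ) *ᵥ b := by
      rw [mulVec_mulVec, ← sub_smul_one_mul_aeval_mij_succ T zs n j (hunitT j hj)]
      congr 1
      set R := aeval T n * (aeval T (mij zs 1 (j + 1)))⁻¹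
      rw [show Q * (T - zs (j + 1) • 1)⁻¹ * Qᵀ * (Q * ((T - zs (j + 1) • 1) * R) * Qᵀ)
        = Q * (T - zs (j + 1) • 1)⁻¹ * (Qᵀ * Q) * (T - zs (j + 1) • 1) * R * Qᵀ by
          simp only [Matrix.mul_assoc], hQ, Matrix.mul_one,
        Matrix.nonsing_inv_mul_cancel_right _ _ ((Matrix.isUnit_iff_isUnit_det _).mp (hunitT j hj))]
    rw [hlanczos, hopt j hj, mulVec_sub]
    abel

end
end

section
/- Let A be a d×d real symmetric matrix, b ∈ R^d, k a positive integer with dim K_k(A,b) = k, Q a d×k matrix with orthonormal columns spanning K_k(A,b), and T = Qᵀ A Q. Let z_1 be a real number outside [λmin(A), λmax(A)], n a polynomial with deg(n) < k, and r_1(x) = n(x)/(x − z_1). Let A_1 = ±(A − z_1 I) be positive definite. Then the Lanczos-FA iterate coincides with the A_1-norm optimal Krylov approximation: Q (T − z_1 I)^{-1} n(T) Qᵀ b = Q (T − z_1 I)^{-1} Qᵀ n(A) b, and this vector minimizes ‖r_1(A)b − x‖_{A_1} over x ∈ K_k(A,b). -/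
open Matrix Polynomial

noncomputable section

theorem shift_posDef_of_lt_lammin {d : ℕ} {A : Matrix (Fin d) (Fin d) ℝ} (hA : A.IsHermitian)
    {z : ℝ} (hz : z < lammin A) : (A - z • 1).PosDef := by
  have hH : (A - z • (1 : Matrix (Fin d) (Fin d) ℝ)).IsHermitian :=
    hA.sub (isHermitian_one.smul (IsSelfAdjoint.all z))
  rw [hH.posDef_iff_eigenvalues_pos]
  intro i
  have h := hH.eigenvalues_mem_spectrum_real i
  generalize hH.eigenvalues i = μ at h ⊢
  rw [← Algebra.algebraMap_eq_smul_one, ← spectrum.sub_singleton_eq,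
    hA.spectrum_real_eq_range_eigenvalues] at h
  obtain ⟨_, ⟨j, rfl⟩, _, rfl, h⟩ := h
  rw [lammin, dif_pos hA] at hz
  have hj := ciInf_le (Set.finite_range hA.eigenvalues).bddBelow j
  dsimp only at h
  linarith

theorem shift_posDef_of_lammax_lt {d : ℕ} {A : Matrix (Fin d) (Fin d) ℝ} (hA : A.IsHermitian)
    {z : ℝ} (hz : lammax A < z) : (-(A - z • 1)).PosDef := by
  rw [neg_sub]
  have hH : (z • (1 : Matrix (Fin d) (Fin d) ℝ) - A).IsHermitian :=
    (isHermitian_one.smul (IsSelfAdjoint.all z)).sub hA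
  rw [hH.posDef_iff_eigenvalues_pos]
  intro i
  have h := hH.eigenvalues_mem_spectrum_real i
  generalize hH.eigenvalues i = μ at h ⊢
  rw [← Algebra.algebraMap_eq_smul_one, ← spectrum.singleton_sub_eq,
    hA.spectrum_real_eq_range_eigenvalues] at h
  obtain ⟨_, rfl, _, ⟨j, rfl⟩, h⟩ := h
  rw [lammax, dif_pos hA] at hz
  have hj := le_ciSup (Set.finite_range hA.eigenvalues).bddAbove j
  dsimp only at h
  linarith

/-- Outside the spectral interval, `shiftSgn A z` is a positive definite multiple of `A - z I`. -/
theorem exists_shiftSgn_eq_smul_and_posDef {d : ℕ} {A : Matrix (Fin d) (Fin d) ℝ}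
    (hA : A.IsHermitian) {z : ℝ} (hz : z < lammin A ∨ lammax A < z) :
    (shiftSgn A z).PosDef ∧ ∃ s : ℝ, s ≠ 0 ∧ shiftSgn A z = s • (A - z • 1) := by
  unfold shiftSgn
  split_ifs with h
  · exact ⟨shift_posDef_of_lt_lammin hA h, 1, one_ne_zero, (one_smul _ _).symm⟩
  · exact ⟨shift_posDef_of_lammax_lt hA (hz.resolve_left h), -1, by norm_num, by
      rw [neg_one_smul]⟩

theorem mul_transpose_mulVec_of_mem_span_cols {d k : ℕ} {Q : Matrix (Fin d) (Fin k) ℝ}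
    (hQ : Qᵀ * Q = 1) {v : Fin d → ℝ} (hv : v ∈ Submodule.span ℝ (Set.range Q.col)) :
    Q *ᵥ (Qᵀ *ᵥ v) = v := by
  rw [← range_mulVecLin] at hv
  obtain ⟨w, rfl⟩ := hv
  rw [mulVecLin_apply, mulVec_mulVec w, hQ, one_mulVec]

/-- Lanczos compression is exact on powers of `A` whose predecessors stay in the column space. -/
theorem compression_pow_mulVec {d k : ℕ} {A : Matrix (Fin d) (Fin d) ℝ} {b : Fin d → ℝ}
    {Q : Matrix (Fin d) (Fin k) ℝ} {m : ℕ}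
    (hb : ∀ j < m, Q *ᵥ (Qᵀ *ᵥ (A ^ j *ᵥ b)) = A ^ j *ᵥ b) :
    ∀ j ≤ m, (Qᵀ * A * Q) ^ j *ᵥ (Qᵀ *ᵥ b) = Qᵀ *ᵥ (A ^ j *ᵥ b) := by
  intro j hj
  induction j with
  | zero => simp
  | succ j ih =>
    rw [pow_succ', ← mulVec_mulVec, ih (by omega), ← mulVec_mulVec, ← mulVec_mulVec,
      hb j (by omega), pow_succ', mulVec_mulVec b A]

theorem compression_aeval_mulVec {d k : ℕ} {A : Matrix (Fin d) (Fin d) ℝ} {b : Fin d → ℝ}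
    {Q : Matrix (Fin d) (Fin k) ℝ} {m : ℕ}
    (hb : ∀ j < m, Q *ᵥ (Qᵀ *ᵥ (A ^ j *ᵥ b)) = A ^ j *ᵥ b) {p : Polynomial ℝ}
    (hp : p.natDegree ≤ m) :
    aeval (Qᵀ * A * Q) p *ᵥ (Qᵀ *ᵥ b) = Qᵀ *ᵥ (aeval A p *ᵥ b) := by
  rw [aeval_eq_sum_range, aeval_eq_sum_range, sum_mulVec, sum_mulVec, mulVec_sum]
  refine Finset.sum_congr rfl fun j hj => ?_
  rw [smul_mulVec, smul_mulVec, mulVec_smul, compression_pow_mulVec hb]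
  have := Finset.mem_range.mp hj
  omega

/-- Galerkin orthogonality implies optimality in the energy norm. -/
theorem mnorm_le_of_galerkin {d k : ℕ} {M : Matrix (Fin d) (Fin d) ℝ} (hM : M.PosSemidef)
    {Q : Matrix (Fin d) (Fin k) ℝ} {u : Fin d → ℝ} {y : Fin k → ℝ}
    (h : Qᵀ *ᵥ (M *ᵥ (u - Q *ᵥ y)) = 0) (w : Fin k → ℝ) :
    mnorm M (u - Q *ᵥ y) ≤ mnorm M (u - Q *ᵥ w) := by
  apply Real.sqrt_le_sqrt
  set e := u - Q *ᵥ y with he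
  have hx : u - Q *ᵥ w = e + Q *ᵥ (y - w) := by
    rw [he, mulVec_sub]; abel
  have hcross : (Q *ᵥ (y - w)) ⬝ᵥ M *ᵥ e = 0 := by
    rw [← vecMul_transpose, ← dotProduct_mulVec, h, dotProduct_zero]
  have hsymm : e ⬝ᵥ M *ᵥ (Q *ᵥ (y - w)) = (Q *ᵥ (y - w)) ⬝ᵥ M *ᵥ e := by
    have hT : Mᵀ = M := by simpa using hM.isHermitian.eq
    rw [dotProduct_mulVec, ← mulVec_transpose, hT, dotProduct_comm]
  have hnn := hM.dotProduct_mulVec_nonneg (Q *ᵥ (y - w))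
  rw [star_trivial] at hnn
  rw [hx, mulVec_add, add_dotProduct, dotProduct_add, dotProduct_add, hsymm, hcross]
  linarith

/-- for `r_1(x) = n(x)/(x - z_1)` with `deg n < k`, the Lanczos-FA iterate
`Q (T - z_1 I)⁻¹ n(T) Qᵀ b` equals `Q (T - z_1 I)⁻¹ Qᵀ n(A) b` and is the `A_1`-norm optimal
approximation to `r_1(A)b` from the Krylov subspace. -/
theorem lanczosFA_base_case_optimal
    {d k : ℕ} (A : Matrix (Fin d) (Fin d) ℝ) (hA : A.IsHermitian) (b : Fin d → ℝ)
    (hk : 0 < k) (hdim : Module.finrank ℝ ↥(Krylov A b k) = k)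
    (Q : Matrix (Fin d) (Fin k) ℝ) (hQ : Qᵀ * Q = 1)
    (hspan : Submodule.span ℝ
      (Set.range fun i : Fin k => fun j : Fin d => Q j i) = Krylov A b k)
    (z₁ : ℝ) (hz : z₁ < lammin A ∨ lammax A < z₁)
    (n : Polynomial ℝ) (hn : n.natDegree < k) :
    (Q * ((Qᵀ * A * Q - z₁ • 1)⁻¹ * aeval (Qᵀ * A * Q) n) * Qᵀ) *ᵥ b
        = (Q * (Qᵀ * A * Q - z₁ • 1)⁻¹ * Qᵀ) *ᵥ ((aeval A n) *ᵥ b)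
    ∧ (Q * ((Qᵀ * A * Q - z₁ • 1)⁻¹ * aeval (Qᵀ * A * Q) n) * Qᵀ) *ᵥ b ∈ Krylov A b k
    ∧ ∀ x ∈ Krylov A b k,
        mnorm (shiftSgn A z₁)
            ((aeval A n * (A - z₁ • 1)⁻¹) *ᵥ b
              - (Q * ((Qᵀ * A * Q - z₁ • 1)⁻¹ * aeval (Qᵀ * A * Q) n) * Qᵀ) *ᵥ b)
          ≤ mnorm (shiftSgn A z₁) ((aeval A n * (A - z₁ • 1)⁻¹) *ᵥ b - x) := by
  obtain ⟨hM, s, hs, hMs⟩ := exists_shiftSgn_eq_smul_and_posDef hA hz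
  have hA1 : IsUnit (A - z₁ • (1 : Matrix (Fin d) (Fin d) ℝ)) :=
    (isUnit_smul_iff (Units.mk0 s hs) _).mp (hMs ▸ hM.isUnit)
  have hTA : Qᵀ * (A - z₁ • 1) * Q = Qᵀ * A * Q - z₁ • 1 := by
    rw [Matrix.mul_sub, Matrix.sub_mul, Matrix.mul_smul, Matrix.mul_one, Matrix.smul_mul, hQ]
  have hT : IsUnit (Qᵀ * A * Q - z₁ • (1 : Matrix (Fin k) (Fin k) ℝ)) := by
    have hinj : Function.Injective Q.mulVec :=
      Function.LeftInverse.injective (g := Qᵀ.mulVec) fun v => by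
        rw [mulVec_mulVec, hQ, one_mulVec]
    have h := (hM.conjTranspose_mul_mul_same hinj).isUnit
    rw [hMs, conjTranspose_eq_transpose_of_trivial, Matrix.mul_smul, Matrix.smul_mul, hTA] at h
    exact (isUnit_smul_iff (Units.mk0 s hs) _).mp h
  have hproj : ∀ v ∈ Krylov A b k, Q *ᵥ (Qᵀ *ᵥ v) = v := fun v hv =>
    mul_transpose_mulVec_of_mem_span_cols hQ (hspan ▸ hv)
  have hn' : aeval (Qᵀ * A * Q) n *ᵥ (Qᵀ *ᵥ b) = Qᵀ *ᵥ (aeval A n *ᵥ b) :=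
    compression_aeval_mulVec (fun j hj => hproj _ (Submodule.subset_span ⟨⟨j, hj⟩, rfl⟩)) hn.le
  set B := A - z₁ • (1 : Matrix (Fin d) (Fin d) ℝ) with hB
  set S := Qᵀ * A * Q - z₁ • (1 : Matrix (Fin k) (Fin k) ℝ)
  set y := S⁻¹ *ᵥ (Qᵀ *ᵥ (aeval A n *ᵥ b)) with hy
  have hiter : (Q * (S⁻¹ * aeval (Qᵀ * A * Q) n) * Qᵀ) *ᵥ b = Q *ᵥ y := by
    rw [← mulVec_mulVec, ← mulVec_mulVec, ← mulVec_mulVec, hn']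
  rw [hiter]
  refine ⟨by rw [← mulVec_mulVec, ← mulVec_mulVec], ?_, fun x hx => ?_⟩
  · rw [← hspan]
    change _ ∈ Submodule.span ℝ (Set.range Q.col)
    rw [← range_mulVecLin]
    exact ⟨y, rfl⟩
  · rw [← hproj x hx]
    refine mnorm_le_of_galerkin hM.posSemidef ?_ _
    have hcomm : B * (aeval A n * B⁻¹) = aeval A n := by
      have hc : Commute B (aeval A n) := by
        have hBn : B = aeval A (X - C z₁) := by
          simp [hB, Algebra.algebraMap_eq_smul_one]
        rw [hBn]
        exact (Commute.all _ n).map (aeval A)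
      rw [← mul_assoc, hc.eq, mul_assoc, mul_nonsing_inv _ ((isUnit_iff_isUnit_det _).mp hA1),
        mul_one]
    have hSy : S *ᵥ y = Qᵀ *ᵥ (aeval A n *ᵥ b) := by
      rw [hy, mulVec_mulVec, mul_nonsing_inv _ ((isUnit_iff_isUnit_det _).mp hT), one_mulVec]
    rw [hMs, smul_mulVec, mulVec_smul, mulVec_sub, mulVec_mulVec b B, hcomm, mulVec_sub,
      ← hSy, ← hTA, ← mulVec_mulVec, ← mulVec_mulVec, sub_self, smul_zero]

end
end
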